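/- There exist an absolute constant c > 0 and n₀ ∈ ℕ such that for all n ≥ n₀ and every convex set K ⊆ ℝⁿ (viewed as a ±1-valued function), the combined Hermite weight of K at levels 0, 1 and 2 satisfies W^{=0}[K] + W^{=1}[K] + W^{=2}[K] ≥ c/n². -/

import Mathlib

open MeasureTheory ProbabilityTheory

/-- The standard Gaussian measure `N(0,1)ⁿ` on `ℝⁿ`. -/
noncomputable def stdGaussian (n : ℕ) : Measure (EuclideanSpace ℝ (Fin n)) :=
  (Measure.pi fun _ : Fin n => gaussianReal 0 1).map
    (EuclideanSpace.equiv (Fin n) ℝ).symm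

open Classical in
/-- The `±1`-valued function associated to a set `K`. -/
noncomputable def pmInd {n : ℕ} (K : Set (EuclideanSpace ℝ (Fin n)))
    (x : EuclideanSpace ℝ (Fin n)) : ℝ :=
  if x ∈ K then 1 else -1

/-- The normalized probabilists' Hermite polynomial `h_d(x) = He_d(x)/√(d!)`,
orthonormal with respect to `N(0,1)`. -/
noncomputable def normHermite (d : ℕ) (x : ℝ) : ℝ :=
  (Polynomial.aeval x (Polynomial.hermite d)) / Real.sqrt (Nat.factorial d)

/-- The Hermite coefficient `f̃(S) = E_{g ∼ N(0,1)ⁿ}[f(g) · ∏ᵢ h_{Sᵢ}(gᵢ)]`. -/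
noncomputable def hermiteCoeff (n : ℕ) (f : EuclideanSpace ℝ (Fin n) → ℝ)
    (S : Fin n → ℕ) : ℝ :=
  ∫ x, f x * ∏ i, normHermite (S i) (x i) ∂(stdGaussian n)

/-- The Hermite weight of `f` at level `j`: `W^{=j}[f] = Σ_{|S| = j} f̃(S)²`. -/
noncomputable def hermiteWeight (n : ℕ) (f : EuclideanSpace ℝ (Fin n) → ℝ)
    (j : ℕ) : ℝ :=
  ∑' S : {S : Fin n → ℕ // ∑ i, S i = j}, (hermiteCoeff n f S.1) ^ 2

section Gaussian

open Module Real Set Filter Topology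
open scoped Pointwise RealInnerProductSpace

lemma exp_le_one_add_add_sq_mul_exp {v d : ℝ} (hd : 0 ≤ d) (hv : v ≤ d) :
    exp v ≤ 1 + v + v ^ 2 * exp d := by
  have h1 : 1 ≤ exp d := one_le_exp hd
  have h2 : v ^ 2 ≤ v ^ 2 * exp d := le_mul_of_one_le_right (sq_nonneg v) h1
  rcases le_or_gt |v| 1 with h | h
  · have := (abs_le.1 (abs_exp_sub_one_sub_id_le h)).2
    linarith
  · rcases lt_abs.1 h with h | h
    · have : exp v ≤ exp d := exp_le_exp.2 hv
      have : exp d ≤ v ^ 2 * exp d := le_mul_of_one_le_left (exp_pos d).le (by nlinarith)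
      linarith
    · have : exp v ≤ 1 := exp_le_one_iff.2 (by linarith)
      nlinarith

/-- If a convex set contains a ball around the origin, a perturbation of a point of the set by `w`
stays in a dilation of the set. -/
lemma Convex.mem_exp_smul_of_smul_sub_mem {E : Type*} [NormedAddCommGroup E] [NormedSpace ℝ E]
    {U : Set E} (hU : Convex ℝ U) {r : ℝ} (hr : 0 < r)
    (hball : Metric.closedBall 0 r ⊆ U) {a s : ℝ} (ha : 0 < a) {x w : E}
    (hs : a⁻¹ * (1 + ‖w‖ / r) ≤ exp s) (hx : a • x - w ∈ U) : x ∈ exp s • U := by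
  have h0 : (0 : E) ∈ U := hball (by simp [hr.le])
  have hw : w ∈ (‖w‖ / r) • U := by
    rcases eq_or_ne w 0 with rfl | hw
    · exact ⟨0, h0, by simp⟩
    · have hw' : 0 < ‖w‖ := norm_pos_iff.2 hw
      rw [mem_smul_set_iff_inv_smul_mem₀ (by positivity)]
      refine hball ?_
      rw [mem_closedBall_zero_iff, norm_smul, norm_of_nonneg (by positivity)]
      field_simp
      exact le_rfl
  have h1 : a • x ∈ (1 + ‖w‖ / r) • U := by
    rw [hU.add_smul zero_le_one (by positivity), one_smul]
    exact ⟨_, hx, _, hw, by simp⟩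
  have h2 : x ∈ (a⁻¹ * (1 + ‖w‖ / r)) • U := by
    rw [mul_smul]
    exact ⟨a • x, h1, inv_smul_smul₀ ha.ne' x⟩
  obtain ⟨y, hy, rfl⟩ := h2
  have hk : 0 ≤ a⁻¹ * (1 + ‖w‖ / r) := by positivity
  rw [mem_smul_set_iff_inv_smul_mem₀ (exp_pos s).ne', smul_smul]
  refine hU.smul_mem_of_zero_mem h0 hy ⟨by positivity, ?_⟩
  rwa [inv_mul_le_iff₀ (exp_pos s), mul_one]

lemma inv_cos_mul_one_add_le_exp {δ t : ℝ} (h0 : 0 ≤ δ) (h1 : δ ≤ 1) (ht : 0 ≤ t) :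
    (cos δ)⁻¹ * (1 + t) ≤ exp (δ ^ 2 + t) := by
  have hc := one_sub_sq_div_two_le_cos (x := δ)
  have hc0 : 0 < cos δ := by nlinarith
  have h2 : (cos δ)⁻¹ ≤ exp (δ ^ 2) := by
    rw [inv_le_iff_one_le_mul₀ hc0]
    have h3 := add_one_le_exp (δ ^ 2)
    have h4 : (δ ^ 2 + 1) * (1 - δ ^ 2 / 2) ≤ exp (δ ^ 2) * cos δ :=
      mul_le_mul h3 hc (by nlinarith) (exp_pos _).le
    have : δ ^ 2 ≤ 1 := by nlinarith
    nlinarith [sq_nonneg δ]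
  rw [exp_add]
  exact mul_le_mul h2 (by linarith [add_one_le_exp t]) (by positivity) (exp_pos _).le

lemma exists_norm_eq_one_forall_inner_le {E : Type*} [NormedAddCommGroup E]
    [InnerProductSpace ℝ E] [CompleteSpace E] {U : Set E} (hU : Convex ℝ U) (hUo : IsOpen U)
    (hne : U.Nonempty) {r : ℝ} (hball : ¬ Metric.closedBall 0 r ⊆ U) :
    ∃ u : E, ‖u‖ = 1 ∧ ∀ x ∈ U, ⟪u, x⟫ ≤ r := by
  obtain ⟨p, hp, hpU⟩ := not_subset.1 hball
  obtain ⟨f, hf⟩ := geometric_hahn_banach_open_point hU hUo hpU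
  set v := (InnerProductSpace.toDual ℝ E).symm f
  have hfv (x : E) : f x = ⟪v, x⟫ := (InnerProductSpace.toDual_symm_apply).symm
  obtain ⟨x₀, hx₀⟩ := hne
  have hv : 0 < ‖v‖ := by
    refine norm_pos_iff.2 fun h => ?_
    have := hf x₀ hx₀
    simp [hfv, h] at this
  refine ⟨‖v‖⁻¹ • v, ?_, fun x hx => ?_⟩
  · rw [norm_smul, norm_inv, norm_norm, inv_mul_cancel₀ hv.ne']
  · rw [real_inner_smul_left, inv_mul_le_iff₀ hv, ← hfv]
    refine (hf x hx).le.trans ?_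
    rw [hfv]
    refine (real_inner_le_norm v p).trans ?_
    gcongr
    simpa using hp

variable {E : Type*} [NormedAddCommGroup E] [InnerProductSpace ℝ E] [FiniteDimensional ℝ E]
  [MeasurableSpace E] [BorelSpace E]

variable (E) in
/-- The standard Gaussian measure has density proportional to `exp (-‖x‖ ^ 2 / 2)`. -/
lemma exists_stdGaussian_eq_withDensity :
    ∃ c : ℝ, 0 < c ∧ ProbabilityTheory.stdGaussian E =
      volume.withDensity fun x => ENNReal.ofReal (c * exp (-(1 / 2) * ‖x‖ ^ 2)) := by
  have hb : (0 : ℝ) < ((1 / 2 : ℝ) : ℂ).re := by simp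
  have hInt : Integrable (fun x : E => exp (-(1 / 2) * ‖x‖ ^ 2)) := by
    have := (GaussianFourier.integrable_cexp_neg_mul_sq_norm_add (V := E) hb 0 0).re
    refine this.congr (.of_forall fun x => ?_)
    simp only [zero_mul, add_zero]
    have : (-((1 / 2 : ℝ) : ℂ) * (‖x‖ : ℂ) ^ 2) = ((-(1 / 2) * ‖x‖ ^ 2 : ℝ) : ℂ) := by
      push_cast; ring
    rw [this, ← Complex.ofReal_exp]
    exact Complex.ofReal_re _
  have hpos : 0 < (π / (1 / 2)) ^ (finrank ℝ E / 2 : ℝ) := by positivity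
  refine ⟨((π / (1 / 2)) ^ (finrank ℝ E / 2 : ℝ))⁻¹, inv_pos.2 hpos, ?_⟩
  set c := ((π / (1 / 2)) ^ (finrank ℝ E / 2 : ℝ))⁻¹ with hc
  have hm : Measurable fun x : E => ENNReal.ofReal (c * exp (-(1 / 2) * ‖x‖ ^ 2)) := by
    fun_prop
  have : IsFiniteMeasure
      (volume.withDensity fun x : E => ENNReal.ofReal (c * exp (-(1 / 2) * ‖x‖ ^ 2))) :=
    isFiniteMeasure_withDensity_ofReal (hInt.const_mul c).2
  refine Measure.ext_of_charFun ?_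
  ext t
  rw [charFun_stdGaussian, charFun_apply,
    integral_withDensity_eq_integral_toReal_smul hm (.of_forall fun _ => ENNReal.ofReal_lt_top)]
  have key := GaussianFourier.integral_cexp_neg_mul_sq_norm_add (V := E) hb Complex.I t
  have hcC : (c : ℂ) * ((π : ℂ) / ((1 / 2 : ℝ) : ℂ)) ^ (finrank ℝ E / 2 : ℂ) = 1 := by
    have h2 : ((π : ℂ) / ((1 / 2 : ℝ) : ℂ)) ^ (finrank ℝ E / 2 : ℂ) =
        (((π / (1 / 2)) ^ (finrank ℝ E / 2 : ℝ) : ℝ) : ℂ) := by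
      rw [Complex.ofReal_cpow (by positivity)]
      push_cast
      rfl
    rw [h2, hc, ← Complex.ofReal_mul, inv_mul_cancel₀ hpos.ne', Complex.ofReal_one]
  calc Complex.exp (-(‖t‖ : ℂ) ^ 2 / 2)
      = (c : ℂ) * ∫ v : E, Complex.exp (-((1 / 2 : ℝ) : ℂ) * ‖v‖ ^ 2 + Complex.I * ⟪t, v⟫) := by
        rw [key, ← mul_assoc, hcC, one_mul, Complex.I_sq]
        congr 1
        push_cast
        ring
    _ = _ := by
        rw [← integral_const_mul]
        congr with v
        rw [ENNReal.toReal_ofReal (by positivity), Complex.real_smul, Complex.exp_add,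
          real_inner_comm v t, mul_comm Complex.I]
        push_cast
        ring

/-- The standard Gaussian measure of a dilated set. -/
lemma stdGaussian_real_exp_smul (s : ℝ) {U : Set E} (hU : MeasurableSet U) :
    (ProbabilityTheory.stdGaussian E).real (exp s • U) =
      ∫ x in U, exp (finrank ℝ E * s - (exp (2 * s) - 1) / 2 * ‖x‖ ^ 2)
        ∂ProbabilityTheory.stdGaussian E := by
  obtain ⟨c, hc, h⟩ := exists_stdGaussian_eq_withDensity E
  have hm : Measurable fun x : E => ENNReal.ofReal (c * exp (-(1 / 2) * ‖x‖ ^ 2)) := by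
    fun_prop
  have hsm : MeasurableSet (exp s • U) := hU.const_smul₀ _
  have hlt (A : Set E) : ∀ᵐ x ∂volume.restrict A,
      ENNReal.ofReal (c * exp (-(1 / 2) * ‖x‖ ^ 2)) < ⊤ :=
    .of_forall fun _ => ENNReal.ofReal_lt_top
  rw [← setIntegral_one_eq_measureReal, h,
    setIntegral_withDensity_eq_setIntegral_toReal_smul₀ hm.aemeasurable (hlt _) _ hsm,
    setIntegral_withDensity_eq_setIntegral_toReal_smul₀ hm.aemeasurable (hlt _) _ hU]
  have hd := Measure.setIntegral_comp_smul_of_pos (volume : Measure E)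
    (fun x => c * exp (-(1 / 2) * ‖x‖ ^ 2)) U (exp_pos s)
  have hpos : 0 < exp s ^ finrank ℝ E := by positivity
  have e1 : ∀ x : E, (ENNReal.ofReal (c * exp (-(1 / 2) * ‖x‖ ^ 2))).toReal =
      c * exp (-(1 / 2) * ‖x‖ ^ 2) := fun x => ENNReal.toReal_ofReal (by positivity)
  simp only [e1, smul_eq_mul, mul_one]
  rw [smul_eq_mul, eq_comm, inv_mul_eq_iff_eq_mul₀ hpos.ne'] at hd
  rw [hd, ← integral_const_mul]
  congr with x
  rw [← exp_nat_mul, norm_smul, norm_of_nonneg (exp_pos s).le, mul_left_comm, ← exp_add,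
    mul_assoc, ← exp_add, mul_pow, ← exp_nat_mul]
  congr 2
  push_cast
  ring

lemma integrable_norm_pow_stdGaussian (k : ℕ) :
    Integrable (fun x : E => ‖x‖ ^ k) (ProbabilityTheory.stdGaussian E) := by
  rcases eq_or_ne k 0 with rfl | hk
  · simp
  · exact (IsGaussian.memLp_id (ProbabilityTheory.stdGaussian E) k
      (ENNReal.natCast_ne_top k)).integrable_norm_pow hk

lemma integral_inner_sq_stdGaussian (u : E) :
    ∫ x, ⟪u, x⟫ ^ 2 ∂ProbabilityTheory.stdGaussian E = ‖u‖ ^ 2 := by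
  have h := variance_dual_stdGaussian (E := E) (InnerProductSpace.toDual ℝ E u)
  rw [variance_of_integral_eq_zero (by fun_prop) (integral_strongDual_stdGaussian _)] at h
  simpa using h

lemma integral_norm_sq_stdGaussian :
    ∫ x, ‖x‖ ^ 2 ∂ProbabilityTheory.stdGaussian E = finrank ℝ E := by
  set b := stdOrthonormalBasis ℝ E
  have hInt (u : E) : Integrable (fun x => ⟪u, x⟫ ^ 2) (ProbabilityTheory.stdGaussian E) := by
    refine ((integrable_norm_pow_stdGaussian 2).const_mul (‖u‖ ^ 2)).mono' (by fun_prop)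
      (.of_forall fun x => ?_)
    rw [norm_of_nonneg (sq_nonneg _), ← mul_pow]
    exact sq_le_sq' (neg_le_of_abs_le (abs_real_inner_le_norm u x)) (real_inner_le_norm u x)
  calc ∫ x, ‖x‖ ^ 2 ∂ProbabilityTheory.stdGaussian E
      = ∫ x, ∑ i, ⟪b i, x⟫ ^ 2 ∂ProbabilityTheory.stdGaussian E := by
        simp_rw [b.sum_sq_inner_right]
    _ = finrank ℝ E := by
        rw [integral_finsetSum _ fun i _ => hInt _]
        simp [integral_inner_sq_stdGaussian]

lemma integral_norm_stdGaussian_le :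
    ∫ x, ‖x‖ ∂ProbabilityTheory.stdGaussian E ≤ √(finrank ℝ E) := by
  refine le_sqrt_of_sq_le ?_
  rw [← integral_norm_sq_stdGaussian]
  have h := variance_eq_sub (μ := ProbabilityTheory.stdGaussian E) (X := fun x : E => ‖x‖)
    (IsGaussian.memLp_two_id (μ := ProbabilityTheory.stdGaussian E)).norm
  have := variance_nonneg (fun x : E => ‖x‖) (ProbabilityTheory.stdGaussian E)
  simp only [Pi.pow_apply] at h
  linarith

/-- Second-order upper bound for the Gaussian measure of a dilated set. -/
lemma exists_stdGaussian_real_exp_smul_le {U : Set E} (hU : MeasurableSet U) :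
    ∃ C : ℝ, 0 ≤ C ∧ ∀ s : ℝ, 0 ≤ s →
      (ProbabilityTheory.stdGaussian E).real (exp s • U) ≤
        (ProbabilityTheory.stdGaussian E).real U +
          (s * |∫ x in U, (finrank ℝ E - ‖x‖ ^ 2) ∂ProbabilityTheory.stdGaussian E| +
            C * s ^ 2) := by
  set γ := ProbabilityTheory.stdGaussian E
  set d : ℝ := (finrank ℝ E : ℝ)
  have hd : 0 ≤ d := Nat.cast_nonneg _
  have hg : Integrable (fun x : E => d - ‖x‖ ^ 2) γ :=
    (integrable_const d).sub (integrable_norm_pow_stdGaussian 2)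
  have hg2 : Integrable (fun x : E => (d - ‖x‖ ^ 2) ^ 2) γ := by
    have : Integrable (fun x : E => d ^ 2 - 2 * d * ‖x‖ ^ 2 + ‖x‖ ^ 4) γ :=
      ((integrable_const (d ^ 2)).sub ((integrable_norm_pow_stdGaussian 2).const_mul (2 * d))).add
        (integrable_norm_pow_stdGaussian 4)
    refine this.congr (.of_forall fun x => ?_)
    dsimp only
    ring
  set M := ∫ x, (d - ‖x‖ ^ 2) ^ 2 ∂γ with hM
  have hM0 : 0 ≤ M := integral_nonneg fun x => sq_nonneg _
  refine ⟨exp d * M + 1, by positivity, fun s hs => ?_⟩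
  set D := ∫ x in U, (d - ‖x‖ ^ 2) ∂γ with hD
  rcases le_or_gt s 1 with hs1 | hs1
  · have hI : IntegrableOn
        (fun x : E => 1 + s * (d - ‖x‖ ^ 2) + s ^ 2 * exp d * (d - ‖x‖ ^ 2) ^ 2) U γ :=
      (((integrable_const 1).add (hg.const_mul s)).add (hg2.const_mul _)).integrableOn
    have hle : γ.real (exp s • U) ≤
        ∫ x in U, (1 + s * (d - ‖x‖ ^ 2) + s ^ 2 * exp d * (d - ‖x‖ ^ 2) ^ 2) ∂γ := by
      rw [stdGaussian_real_exp_smul s hU]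
      refine integral_mono_of_nonneg (.of_forall fun x => (exp_pos _).le) hI
        (.of_forall fun x => ?_)
      have h0 : 0 ≤ ‖x‖ ^ 2 := sq_nonneg _
      calc exp (d * s - (exp (2 * s) - 1) / 2 * ‖x‖ ^ 2) ≤ exp (s * (d - ‖x‖ ^ 2)) := by
            refine exp_le_exp.2 ?_
            have := add_one_le_exp (2 * s)
            nlinarith
        _ ≤ 1 + s * (d - ‖x‖ ^ 2) + (s * (d - ‖x‖ ^ 2)) ^ 2 * exp d :=
            exp_le_one_add_add_sq_mul_exp hd (by nlinarith)
        _ = _ := by ring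
    have heq : ∫ x in U, (1 + s * (d - ‖x‖ ^ 2) + s ^ 2 * exp d * (d - ‖x‖ ^ 2) ^ 2) ∂γ =
        γ.real U + s * D + s ^ 2 * exp d * ∫ x in U, (d - ‖x‖ ^ 2) ^ 2 ∂γ := by
      have hi : Integrable (fun x : E => 1 + s * (d - ‖x‖ ^ 2)) (γ.restrict U) :=
        ((integrable_const 1).add (hg.const_mul s)).restrict
      rw [integral_add hi (hg2.const_mul _).restrict, integral_add (integrable_const 1)
        (hg.const_mul s).restrict, integral_const_mul, integral_const_mul]
      simp [hD]
    have hMU : ∫ x in U, (d - ‖x‖ ^ 2) ^ 2 ∂γ ≤ M :=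
      setIntegral_le_integral hg2 (.of_forall fun x => sq_nonneg _)
    have h1 : s * D ≤ s * |D| := mul_le_mul_of_nonneg_left (le_abs_self D) hs
    have h2 := mul_le_mul_of_nonneg_left hMU (by positivity : 0 ≤ s ^ 2 * exp d)
    nlinarith [sq_nonneg s]
  · have h1 : γ.real (exp s • U) ≤ 1 := measureReal_le_one
    have h2 : 0 ≤ γ.real U := measureReal_nonneg
    have h3 : 0 ≤ exp d * M * s ^ 2 := by positivity
    have h4 : 0 ≤ s * |D| := by positivity
    nlinarith

/-- The probability that a rotation by a small angle enters a convex set containing a ball around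
the origin. -/
lemma Convex.stdGaussian_prod_rotation_le {U : Set E} (hU : Convex ℝ U) (hUm : MeasurableSet U)
    {r : ℝ} (hr : 0 < r) (hball : Metric.closedBall 0 r ⊆ U) {C D : ℝ} (hC : 0 ≤ C) (hD : 0 ≤ D)
    (hCD : ∀ s : ℝ, 0 ≤ s → (ProbabilityTheory.stdGaussian E).real (exp s • U) ≤
      (ProbabilityTheory.stdGaussian E).real U + (s * D + C * s ^ 2))
    {δ : ℝ} (hδ0 : 0 ≤ δ) (hδ1 : δ ≤ 1) :
    ((ProbabilityTheory.stdGaussian E).prod (ProbabilityTheory.stdGaussian E)).real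
      {p | cos δ • p.1 - sin δ • p.2 ∈ U ∧ p.1 ∉ U} ≤
    D * (δ * (√(finrank ℝ E) / r) + δ ^ 2) +
      C * (2 * δ ^ 2 * (finrank ℝ E / r ^ 2) + 2 * δ ^ 4) := by
  set γ := ProbabilityTheory.stdGaussian E
  have hcos : 0 < cos δ := by nlinarith [one_sub_sq_div_two_le_cos (x := δ)]
  have hsin0 : 0 ≤ sin δ := sin_nonneg_of_nonneg_of_le_pi hδ0 (by linarith [two_le_pi])
  have hsin : sin δ ≤ δ := sin_le hδ0
  have h0 : (0 : E) ∈ U := hball (by simp [hr.le])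
  have hTm : MeasurableSet {p : E × E | cos δ • p.1 - sin δ • p.2 ∈ U ∧ p.1 ∉ U} :=
    (measurableSet_preimage (f := fun p : E × E => cos δ • p.1 - sin δ • p.2)
      (by fun_prop) hUm).inter (measurable_fst hUm.compl)
  set s : E → ℝ := fun w => δ ^ 2 + δ / r * ‖w‖ with hs
  have hs0 (w : E) : 0 ≤ s w := by positivity
  have hslice (w : E) :
      γ ((fun x => (x, w)) ⁻¹' {p : E × E | cos δ • p.1 - sin δ • p.2 ∈ U ∧ p.1 ∉ U}) ≤
        ENNReal.ofReal (s w * D + C * s w ^ 2) := by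
    have hsub : (fun x => (x, w)) ⁻¹' {p : E × E | cos δ • p.1 - sin δ • p.2 ∈ U ∧ p.1 ∉ U} ⊆
        (exp (s w) • U) \ U := by
      rintro x ⟨hx, hxU⟩
      refine ⟨hU.mem_exp_smul_of_smul_sub_mem hr hball hcos ?_ hx, hxU⟩
      refine (inv_cos_mul_one_add_le_exp hδ0 hδ1 (by positivity)).trans (exp_le_exp.2 ?_)
      rw [norm_smul, norm_of_nonneg hsin0]
      simp only [hs]
      rw [div_mul_eq_mul_div]
      gcongr
    have hUs : U ⊆ exp (s w) • U := by
      intro x hx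
      rw [mem_smul_set_iff_inv_smul_mem₀ (exp_pos _).ne']
      exact hU.smul_mem_of_zero_mem h0 hx
        ⟨by positivity, inv_le_one_of_one_le₀ (one_le_exp (hs0 w))⟩
    refine (measure_mono hsub).trans ?_
    rw [← ofReal_measureReal, measureReal_sdiff hUs hUm]
    refine ENNReal.ofReal_le_ofReal ?_
    linarith [hCD (s w) (hs0 w)]
  have hi1 : Integrable (fun w : E => ‖w‖) γ := by
    simpa using integrable_norm_pow_stdGaussian (E := E) 1
  have hi2 : Integrable (fun w : E => ‖w‖ ^ 2) γ := integrable_norm_pow_stdGaussian 2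
  have hsi : Integrable s γ := (integrable_const _).add (hi1.const_mul _)
  have hqi : Integrable (fun w : E => 2 * δ ^ 4 + 2 * (δ / r) ^ 2 * ‖w‖ ^ 2) γ :=
    (integrable_const _).add (hi2.const_mul _)
  have hbd : Integrable
      (fun w => s w * D + C * (2 * δ ^ 4 + 2 * (δ / r) ^ 2 * ‖w‖ ^ 2)) γ :=
    (hsi.mul_const D).add (hqi.const_mul C)
  have hsint : ∫ w, s w ∂γ = δ ^ 2 + δ / r * ∫ w, ‖w‖ ∂γ := by
    rw [integral_add (integrable_const _) (hi1.const_mul _), integral_const_mul]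
    simp
  have hqint : ∫ w : E, (2 * δ ^ 4 + 2 * (δ / r) ^ 2 * ‖w‖ ^ 2) ∂γ =
      2 * δ ^ 4 + 2 * (δ / r) ^ 2 * finrank ℝ E := by
    rw [integral_add (integrable_const _) (hi2.const_mul _), integral_const,
      integral_const_mul, integral_norm_sq_stdGaussian]
    simp
  have hnn (w : E) : 0 ≤ s w * D + C * (2 * δ ^ 4 + 2 * (δ / r) ^ 2 * ‖w‖ ^ 2) := by
    have := hs0 w
    positivity
  rw [measureReal_def]
  refine ENNReal.toReal_le_of_le_ofReal ?_ (b := _) (a := _) ?_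
  · positivity
  rw [Measure.prod_apply_symm hTm]
  calc _ ≤ ∫⁻ w, ENNReal.ofReal
          (s w * D + C * (2 * δ ^ 4 + 2 * (δ / r) ^ 2 * ‖w‖ ^ 2)) ∂γ := by
        refine lintegral_mono fun w => (hslice w).trans (ENNReal.ofReal_le_ofReal ?_)
        gcongr
        simp only [hs]
        nlinarith [sq_nonneg (δ ^ 2 - δ / r * ‖w‖)]
    _ = ENNReal.ofReal (∫ w, (s w * D + C * (2 * δ ^ 4 + 2 * (δ / r) ^ 2 * ‖w‖ ^ 2)) ∂γ) :=
        (ofReal_integral_eq_lintegral_ofReal hbd (.of_forall hnn)).symm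
    _ ≤ _ := by
        refine ENNReal.ofReal_le_ofReal ?_
        rw [integral_add (hsi.mul_const D) (hqi.const_mul C), integral_mul_const,
          integral_const_mul, hsint, hqint]
        have h1 : δ / r * ∫ w, ‖w‖ ∂γ ≤ δ / r * √(finrank ℝ E) :=
          mul_le_mul_of_nonneg_left integral_norm_stdGaussian_le (by positivity)
        have h2 := mul_le_mul_of_nonneg_left h1 hD
        have e1 : δ * (√(finrank ℝ E) / r) = δ / r * √(finrank ℝ E) := by ring
        have e2 : 2 * δ ^ 2 * (finrank ℝ E / r ^ 2) = 2 * (δ / r) ^ 2 * finrank ℝ E := by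
          field_simp
        rw [e1, e2]
        linarith

/-- Rotating a pair of independent Gaussian vectors in `N` steps: one of the steps leaves `U`
whenever the endpoints are separated by `U`. -/
lemma stdGaussian_real_mul_compl_le_nat_mul {U : Set E} (hU : MeasurableSet U) {N : ℕ}
    (hN : N ≠ 0) :
    (ProbabilityTheory.stdGaussian E).real U * (ProbabilityTheory.stdGaussian E).real Uᶜ ≤
      N * ((ProbabilityTheory.stdGaussian E).prod (ProbabilityTheory.stdGaussian E)).real
        {p | cos (π / 2 / N) • p.1 - sin (π / 2 / N) • p.2 ∈ U ∧ p.1 ∉ U} := by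
  set γ := ProbabilityTheory.stdGaussian E
  set δ : ℝ := π / 2 / N with hδ
  set T : Set (E × E) := {p | cos δ • p.1 - sin δ • p.2 ∈ U ∧ p.1 ∉ U} with hT
  have hTm : MeasurableSet T :=
    (measurableSet_preimage (f := fun p : E × E => cos δ • p.1 - sin δ • p.2)
      (by fun_prop) hU).inter (measurable_fst hU.compl)
  have hrot (i : ℕ) :
      (γ.prod γ).real (ContinuousLinearMap.rotation ((i + 1 : ℕ) * δ) ⁻¹' T) =
        (γ.prod γ).real T := by
    rw [← map_measureReal_apply (by fun_prop) hTm,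
      IsGaussian.map_rotation_eq_self integral_id_stdGaussian]
  have hcover : U ×ˢ Uᶜ ⊆
      ⋃ i ∈ Finset.range N, ContinuousLinearMap.rotation ((i + 1 : ℕ) * δ) ⁻¹' T := by
    rintro ⟨x, y⟩ ⟨hx, hy⟩
    by_contra hcon
    simp only [mem_iUnion, not_exists] at hcon
    have hall : ∀ i ≤ N, cos (i * δ) • x + sin (i * δ) • y ∈ U := by
      intro i
      induction i with
      | zero => intro _; simpa using hx
      | succ i ih =>
        intro hi
        by_contra hni
        refine hcon i (Finset.mem_range.2 hi) ⟨?_, hni⟩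
        have hprev := ih (by omega)
        have hi' : (i : ℝ) * δ = (i + 1 : ℕ) * δ - δ := by push_cast; ring
        rw [hi', cos_sub, sin_sub] at hprev
        simp only [ContinuousLinearMap.rotation_apply]
        convert! hprev using 1
        module
    refine hy ?_
    have := hall N le_rfl
    have hNδ : (N : ℝ) * δ = π / 2 := by
      rw [hδ]
      field_simp
    simpa [hNδ] using this
  calc γ.real U * γ.real Uᶜ = (γ.prod γ).real (U ×ˢ Uᶜ) := (measureReal_prod_prod _ _).symm
    _ ≤ _ := measureReal_mono hcover (measure_ne_top _ _)
    _ ≤ _ := measureReal_biUnion_finset_le _ _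
    _ = N * (γ.prod γ).real T := by
      rw [Finset.sum_congr rfl fun i _ => hrot i]
      simp

/-- A convex set containing a ball of radius `r` around the origin grows under dilation at a rate
controlling its Gaussian variance. -/
lemma Convex.stdGaussian_real_mul_compl_le {U : Set E} (hU : Convex ℝ U) (hUm : MeasurableSet U)
    {r : ℝ} (hr : 0 < r) (hball : Metric.closedBall 0 r ⊆ U) :
    (ProbabilityTheory.stdGaussian E).real U * (ProbabilityTheory.stdGaussian E).real Uᶜ ≤
      π / 2 * (|∫ x in U, (finrank ℝ E - ‖x‖ ^ 2) ∂ProbabilityTheory.stdGaussian E| *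
        (√(finrank ℝ E) / r)) := by
  obtain ⟨C, hC, hCD⟩ := exists_stdGaussian_real_exp_smul_le hUm
  set D := |∫ x in U, (finrank ℝ E - ‖x‖ ^ 2) ∂ProbabilityTheory.stdGaussian E|
  set A := √(finrank ℝ E) / r
  set B : ℝ := finrank ℝ E / r ^ 2
  have hlim : Tendsto (fun N : ℕ => π / 2 / (N : ℝ)) atTop (𝓝 0) :=
    tendsto_const_div_atTop_nhds_zero_nat _
  have hcont : Continuous fun δ : ℝ =>
      π / 2 * (D * (A + δ) + C * (2 * δ * B + 2 * δ ^ 3)) := by fun_prop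
  have htend := (hcont.tendsto 0).comp hlim
  simp only [add_zero, mul_zero, zero_mul, ne_eq, OfNat.ofNat_ne_zero, not_false_eq_true,
    zero_pow] at htend
  refine ge_of_tendsto htend ?_
  filter_upwards [eventually_ge_atTop 2] with N hN
  have hN' : (2 : ℝ) ≤ N := by exact_mod_cast hN
  refine (stdGaussian_real_mul_compl_le_nat_mul hUm (N := N) (by omega)).trans ?_
  have hδ1 : π / 2 / (N : ℝ) ≤ 1 := by
    rw [div_le_one (by positivity)]
    linarith [pi_le_four]
  have hstep := hU.stdGaussian_prod_rotation_le hUm hr hball hC (abs_nonneg _) hCD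
    (by positivity : 0 ≤ π / 2 / (N : ℝ)) hδ1
  refine (mul_le_mul_of_nonneg_left hstep (Nat.cast_nonneg N)).trans_eq ?_
  simp only [Function.comp_apply]
  have hNδ : (N : ℝ) * (π / 2 / N) = π / 2 := by field_simp
  generalize π / 2 / (N : ℝ) = δ at hNδ ⊢
  rw [← hNδ]
  ring

lemma gaussianReal_real_Icc_le {a b : ℝ} (hab : a ≤ b) :
    (gaussianReal 0 1).real (Icc a b) ≤ (b - a) / 2 := by
  have hpdf (x : ℝ) : gaussianPDFReal 0 1 x ≤ 1 / 2 := by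
    rw [gaussianPDFReal_def, one_div]
    have h2 : (2 : ℝ) ≤ √(2 * π * ((1 : NNReal) : ℝ)) := by
      refine le_sqrt_of_sq_le ?_
      simp only [NNReal.coe_one, mul_one]
      nlinarith [pi_gt_three]
    have h3 : exp (-(x - 0) ^ 2 / (2 * ((1 : NNReal) : ℝ))) ≤ 1 := by
      rw [exp_le_one_iff]
      simp only [NNReal.coe_one, mul_one]
      nlinarith [sq_nonneg (x - 0)]
    exact (mul_le_of_le_one_right (by positivity) h3).trans (inv_anti₀ two_pos h2)
  rw [measureReal_def, gaussianReal_apply_eq_integral 0 one_ne_zero,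
    ENNReal.toReal_ofReal (integral_nonneg fun x => gaussianPDFReal_nonneg _ _ _)]
  calc ∫ x in Icc a b, gaussianPDFReal 0 1 x ≤ ∫ _ in Icc a b, (1 / 2 : ℝ) :=
        integral_mono (integrable_gaussianPDFReal 0 1).restrict (integrable_const _) hpdf
    _ = (b - a) / 2 := by
        simp [hab]
        ring

lemma stdGaussian_real_inner_mem_Icc_le {u : E} (hu : ‖u‖ = 1) {a b : ℝ} (hab : a ≤ b) :
    (ProbabilityTheory.stdGaussian E).real {x | ⟪u, x⟫ ∈ Icc a b} ≤ (b - a) / 2 := by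
  have h := IsGaussian.map_eq_gaussianReal (μ := ProbabilityTheory.stdGaussian E)
    (InnerProductSpace.toDual ℝ E u)
  rw [integral_strongDual_stdGaussian, variance_dual_stdGaussian, LinearIsometryEquiv.norm_map, hu,
    one_pow, Real.toNNReal_one] at h
  refine le_trans (le_of_eq ?_) (gaussianReal_real_Icc_le hab)
  rw [← h, map_measureReal_apply (by fun_prop) measurableSet_Icc]
  rfl

/-- A set of substantial Gaussian measure on one side of a hyperplane close to the origin has its
mean bounded away from that hyperplane. -/
lemma setIntegral_inner_le_of_forall_inner_le {U : Set E} (hUm : MeasurableSet U) {u : E}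
    (hu : ‖u‖ = 1) (hUu : ∀ x ∈ U, ⟪u, x⟫ ≤ 1 / 64)
    (hU : 1 / 4 ≤ (ProbabilityTheory.stdGaussian E).real U) :
    ∫ x in U, ⟪u, x⟫ ∂ProbabilityTheory.stdGaussian E ≤ -(1 / 128) := by
  set γ := ProbabilityTheory.stdGaussian E
  set H : Set E := {x | ⟪u, x⟫ < -(1 / 4)} with hH
  have hHm : MeasurableSet H := measurableSet_lt (by fun_prop) (by fun_prop)
  have hInt : Integrable (fun x => ⟪u, x⟫) γ :=
    (IsGaussian.integrable_id (μ := γ)).const_inner u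
  have hsub : U \ H ⊆ {x | ⟪u, x⟫ ∈ Icc (-(1 / 4)) (1 / 64)} := fun x hx =>
    ⟨not_lt.1 hx.2, hUu x hx.1⟩
  have h1 : γ.real (U \ H) ≤ (1 / 64 - -(1 / 4)) / 2 :=
    (measureReal_mono hsub).trans (stdGaussian_real_inner_mem_Icc_le hu (by norm_num))
  have h2 : γ.real (U ∩ H) + γ.real (U \ H) = γ.real U := measureReal_inter_add_sdiff hHm
  have h3 : ∫ x in U, ⟪u, x⟫ ∂γ = ∫ x in U ∩ H, ⟪u, x⟫ ∂γ + ∫ x in U \ H, ⟪u, x⟫ ∂γ :=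
    (integral_inter_add_sdiff hHm hInt.integrableOn).symm
  have h4 : ∫ x in U ∩ H, ⟪u, x⟫ ∂γ ≤ γ.real (U ∩ H) * -(1 / 4) := by
    rw [← smul_eq_mul, ← setIntegral_const]
    exact setIntegral_mono_on hInt.integrableOn (integrable_const _).integrableOn (hUm.inter hHm)
      fun x hx => hx.2.le
  have h5 : ∫ x in U \ H, ⟪u, x⟫ ∂γ ≤ γ.real (U \ H) * (1 / 64) := by
    rw [← smul_eq_mul, ← setIntegral_const]
    exact setIntegral_mono_on hInt.integrableOn (integrable_const _).integrableOn (hUm.diff hHm)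
      fun x hx => hUu x hx.1
  linarith

lemma stdGaussian_absolutelyContinuous : ProbabilityTheory.stdGaussian E ≪ volume := by
  obtain ⟨c, -, h⟩ := exists_stdGaussian_eq_withDensity E
  rw [h]
  exact withDensity_absolutelyContinuous _ _

end Gaussian

section HermiteWeight

open Module Real Set Filter Topology
open scoped RealInnerProductSpace

lemma normHermite_zero (x : ℝ) : normHermite 0 x = 1 := by
  simp [normHermite]

lemma normHermite_one (x : ℝ) : normHermite 1 x = x := by
  simp [normHermite]

lemma normHermite_two (x : ℝ) : normHermite 2 x = (√2)⁻¹ * (x ^ 2 - 1) := by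
  simp [normHermite, div_eq_inv_mul, sq]

lemma prod_normHermite_single {n : ℕ} (i : Fin n) (k : ℕ) (x : Fin n → ℝ) :
    ∏ j, normHermite (Pi.single (M := fun _ : Fin n => ℕ) i k j) (x j) = normHermite k (x i) := by
  rw [Finset.prod_eq_single i]
  · simp
  · intro j _ hj
    simp [Pi.single_eq_of_ne hj, normHermite_zero]
  · simp

lemma finite_setOf_sum_eq (n j : ℕ) : {S : Fin n → ℕ | ∑ i, S i = j}.Finite :=
  (Set.finite_Iic fun _ : Fin n => j).subset fun _ hS i =>
    (Finset.single_le_sum (fun _ _ => Nat.zero_le _) (Finset.mem_univ i)).trans hS.le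

lemma sum_hermiteCoeff_single_sq_le (n : ℕ) (f : EuclideanSpace ℝ (Fin n) → ℝ) {k : ℕ}
    (hk : k ≠ 0) :
    ∑ i, hermiteCoeff n f (Pi.single i k) ^ 2 ≤ hermiteWeight n f k := by
  have : Fintype {S : Fin n → ℕ // ∑ i, S i = k} := (finite_setOf_sum_eq n k).fintype
  have hs : Summable fun S : {S : Fin n → ℕ // ∑ i, S i = k} => hermiteCoeff n f S.1 ^ 2 :=
    (hasSum_fintype _).summable
  have hi : Function.Injective fun i : Fin n =>
      (⟨Pi.single i k, by simp⟩ : {S : Fin n → ℕ // ∑ i, S i = k}) := by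
    intro i j hij
    have h := congrFun (congrArg Subtype.val hij) i
    by_contra hne
    simp [Pi.single_eq_of_ne hne, hk] at h
  have := tsum_comp_le_tsum_of_inj hs (fun _ => sq_nonneg _) hi
  rwa [tsum_fintype] at this

lemma hermiteWeight_nonneg (n : ℕ) (f : EuclideanSpace ℝ (Fin n) → ℝ) (j : ℕ) :
    0 ≤ hermiteWeight n f j :=
  tsum_nonneg fun _ => sq_nonneg _

lemma hermiteWeight_zero (n : ℕ) (f : EuclideanSpace ℝ (Fin n) → ℝ) :
    hermiteWeight n f 0 = hermiteCoeff n f 0 ^ 2 := by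
  have : Unique {S : Fin n → ℕ // ∑ i, S i = 0} :=
    { default := ⟨0, by simp⟩
      uniq := fun S => Subtype.ext (funext fun i => by
        simpa using Finset.sum_eq_zero_iff.1 S.2 i (Finset.mem_univ i)) }
  rw [hermiteWeight, tsum_eq_single (⟨0, by simp⟩ : {S : Fin n → ℕ // ∑ i, S i = 0})]
  exact fun S hS => absurd (Subsingleton.elim _ _) hS

lemma stdGaussian_eq (n : ℕ) :
    _root_.stdGaussian n = ProbabilityTheory.stdGaussian (EuclideanSpace ℝ (Fin n)) :=
  map_pi_eq_stdGaussian

variable {n : ℕ} {K : Set (EuclideanSpace ℝ (Fin n))}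

lemma integral_pmInd_mul (hK : Convex ℝ K) {g : EuclideanSpace ℝ (Fin n) → ℝ}
    (hg : Integrable g (ProbabilityTheory.stdGaussian (EuclideanSpace ℝ (Fin n)))) :
    ∫ x, pmInd K x * g x ∂(_root_.stdGaussian n) =
      2 * ∫ x in interior K, g x ∂ProbabilityTheory.stdGaussian (EuclideanSpace ℝ (Fin n)) -
        ∫ x, g x ∂ProbabilityTheory.stdGaussian (EuclideanSpace ℝ (Fin n)) := by
  rw [stdGaussian_eq]
  set γ := ProbabilityTheory.stdGaussian (EuclideanSpace ℝ (Fin n))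
  have hm : MeasurableSet (interior K) := isOpen_interior.measurableSet
  have hae : ∀ᵐ x ∂γ, x ∉ frontier K :=
    measure_eq_zero_iff_ae_notMem.1
      (stdGaussian_absolutelyContinuous (hK.addHaar_frontier volume))
  have hcongr : ∫ x, pmInd K x * g x ∂γ =
      ∫ x, (2 * (interior K).indicator g x - g x) ∂γ := by
    refine integral_congr_ae ?_
    filter_upwards [hae] with x hx
    by_cases hxK : x ∈ K
    · have hxi : x ∈ interior K := by
        by_contra h
        exact hx ⟨subset_closure hxK, h⟩
      simp only [pmInd, hxK, if_true, indicator_of_mem hxi]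
      ring
    · have hxi : x ∉ interior K := fun h => hxK (interior_subset h)
      simp [pmInd, hxK, indicator_of_notMem hxi]
  rw [hcongr, integral_sub ((hg.indicator hm).const_mul 2) hg, integral_const_mul,
    integral_indicator hm]

lemma hermiteCoeff_pmInd_zero (hK : Convex ℝ K) :
    hermiteCoeff n (pmInd K) 0 =
      2 * (ProbabilityTheory.stdGaussian (EuclideanSpace ℝ (Fin n))).real (interior K) - 1 := by
  have := integral_pmInd_mul hK (integrable_const 1)
  simpa [hermiteCoeff, normHermite_zero] using this

lemma EuclideanSpace.integrable_apply_stdGaussian (i : Fin n) :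
    Integrable (fun x : EuclideanSpace ℝ (Fin n) => x i)
      (ProbabilityTheory.stdGaussian (EuclideanSpace ℝ (Fin n))) :=
  (EuclideanSpace.proj (𝕜 := ℝ) i).integrable_comp IsGaussian.integrable_id

lemma EuclideanSpace.integrable_apply_sq_stdGaussian (i : Fin n) :
    Integrable (fun x : EuclideanSpace ℝ (Fin n) => x i ^ 2)
      (ProbabilityTheory.stdGaussian (EuclideanSpace ℝ (Fin n))) :=
  ((EuclideanSpace.proj (𝕜 := ℝ) i).comp_memLp' IsGaussian.memLp_two_id).integrable_sq

lemma EuclideanSpace.integral_apply_sq_stdGaussian (i : Fin n) :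
    ∫ x : EuclideanSpace ℝ (Fin n), x i ^ 2
      ∂ProbabilityTheory.stdGaussian (EuclideanSpace ℝ (Fin n)) = 1 := by
  have := integral_inner_sq_stdGaussian (EuclideanSpace.single i (1 : ℝ))
  simpa [EuclideanSpace.inner_single_left] using this

lemma hermiteCoeff_pmInd_single_one (hK : Convex ℝ K) (i : Fin n) :
    hermiteCoeff n (pmInd K) (Pi.single i 1) =
      2 * ∫ x in interior K, x i
        ∂ProbabilityTheory.stdGaussian (EuclideanSpace ℝ (Fin n)) := by
  have h := integral_pmInd_mul hK (EuclideanSpace.integrable_apply_stdGaussian i)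
  have h0 : ∫ x : EuclideanSpace ℝ (Fin n), x i
      ∂ProbabilityTheory.stdGaussian (EuclideanSpace ℝ (Fin n)) = 0 :=
    integral_strongDual_stdGaussian (EuclideanSpace.proj (𝕜 := ℝ) i)
  rw [h0, sub_zero] at h
  rw [← h, hermiteCoeff]
  congr with x
  rw [prod_normHermite_single, normHermite_one]

lemma hermiteCoeff_pmInd_single_two (hK : Convex ℝ K) (i : Fin n) :
    hermiteCoeff n (pmInd K) (Pi.single i 2) =
      √2 * ∫ x in interior K, (x i ^ 2 - 1)
        ∂ProbabilityTheory.stdGaussian (EuclideanSpace ℝ (Fin n)) := by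
  have hi := EuclideanSpace.integrable_apply_sq_stdGaussian i
  have h := integral_pmInd_mul hK ((hi.sub (integrable_const 1)).const_mul (√2)⁻¹)
  simp only [Pi.sub_apply] at h
  rw [integral_const_mul, integral_const_mul, integral_sub hi (integrable_const 1),
    EuclideanSpace.integral_apply_sq_stdGaussian] at h
  simp only [integral_const, probReal_univ, one_smul, sub_self, mul_zero, sub_zero] at h
  have h2 : (2 : ℝ) * (√2)⁻¹ = √2 := by
    rw [← div_eq_mul_inv, div_sqrt]
  rw [← mul_assoc, h2] at h
  rw [← h, hermiteCoeff]
  congr with x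
  rw [prod_normHermite_single, normHermite_two]

/-- The level-one weight bounds the mean of `K` in any direction. -/
lemma sq_setIntegral_inner_le_hermiteWeight (hK : Convex ℝ K) {u : EuclideanSpace ℝ (Fin n)}
    (hu : ‖u‖ = 1) :
    4 * (∫ x in interior K, ⟪u, x⟫
      ∂ProbabilityTheory.stdGaussian (EuclideanSpace ℝ (Fin n))) ^ 2 ≤
      hermiteWeight n (pmInd K) 1 := by
  refine le_trans ?_ (sum_hermiteCoeff_single_sq_le n _ one_ne_zero)
  set γ := ProbabilityTheory.stdGaussian (EuclideanSpace ℝ (Fin n))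
  have hsum : ∑ i, u i * hermiteCoeff n (pmInd K) (Pi.single i 1) =
      2 * ∫ x in interior K, ⟪u, x⟫ ∂γ := by
    simp_rw [hermiteCoeff_pmInd_single_one hK, PiLp.inner_apply, RCLike.inner_apply, conj_trivial]
    rw [integral_finsetSum _ fun i _ =>
      ((EuclideanSpace.integrable_apply_stdGaussian i).mul_const (u i)).restrict, Finset.mul_sum]
    refine Finset.sum_congr rfl fun i _ => ?_
    rw [integral_mul_const]
    ring
  have hcs := Finset.sum_mul_sq_le_sq_mul_sq Finset.univ (fun i => u i)
    fun i => hermiteCoeff n (pmInd K) (Pi.single i 1)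
  rw [hsum, ← EuclideanSpace.real_norm_sq_eq, hu] at hcs
  linarith

/-- The level-two weight bounds the derivative of the Gaussian measure of `K` under dilation. -/
lemma sq_setIntegral_sub_norm_sq_le_hermiteWeight (hK : Convex ℝ K) :
    2 * (∫ x in interior K, (n - ‖x‖ ^ 2)
      ∂ProbabilityTheory.stdGaussian (EuclideanSpace ℝ (Fin n))) ^ 2 ≤
      n * hermiteWeight n (pmInd K) 2 := by
  refine le_trans ?_ (mul_le_mul_of_nonneg_left
    (sum_hermiteCoeff_single_sq_le n _ two_ne_zero) (Nat.cast_nonneg n))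
  set γ := ProbabilityTheory.stdGaussian (EuclideanSpace ℝ (Fin n))
  have hsum : ∑ i, hermiteCoeff n (pmInd K) (Pi.single i 2) =
      -(√2 * ∫ x in interior K, (n - ‖x‖ ^ 2) ∂γ) := by
    simp_rw [hermiteCoeff_pmInd_single_two hK, EuclideanSpace.real_norm_sq_eq]
    have hi (i : Fin n) : Integrable (fun x : EuclideanSpace ℝ (Fin n) => x i ^ 2 - 1)
        (γ.restrict (interior K)) :=
      ((EuclideanSpace.integrable_apply_sq_stdGaussian i).sub (integrable_const 1)).restrict
    rw [← Finset.mul_sum, ← integral_finsetSum _ fun i _ => hi i, ← mul_neg, ← integral_neg]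
    congr with x
    simp
  have hcs := sq_sum_le_card_mul_sum_sq (s := Finset.univ)
    (f := fun i => hermiteCoeff n (pmInd K) (Pi.single i 2))
  rw [hsum, neg_sq, mul_pow, sq_sqrt zero_le_two] at hcs
  simpa using hcs

end HermiteWeight

/-- Every convex set has Hermite weight at least `c/n²` at levels 0, 1 and 2 combined. -/
theorem hermite_weight_convex :
    ∃ c : ℝ, 0 < c ∧ ∃ n₀ : ℕ, ∀ n : ℕ, n₀ ≤ n →
      ∀ K : Set (EuclideanSpace ℝ (Fin n)),
        Convex ℝ K →
        c / (n : ℝ) ^ 2 ≤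
          hermiteWeight n (pmInd K) 0 + hermiteWeight n (pmInd K) 1
            + hermiteWeight n (pmInd K) 2 := by
  refine ⟨1 / 2 ^ 22, by positivity, 1, fun n hn K hK => ?_⟩
  have hn1 : (1 : ℝ) ≤ n := by exact_mod_cast hn
  have hn0 : (0 : ℝ) < n := by linarith
  have hW0 := hermiteWeight_nonneg n (pmInd K) 0
  have hW1 := hermiteWeight_nonneg n (pmInd K) 1
  have hW2 := hermiteWeight_nonneg n (pmInd K) 2
  have hcn : (1 / 2 ^ 22 : ℝ) / (n : ℝ) ^ 2 ≤ 1 / 2 ^ 22 :=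
    div_le_self (by positivity) (one_le_pow₀ hn1)
  set γ := ProbabilityTheory.stdGaussian (EuclideanSpace ℝ (Fin n))
  set U := interior K
  have hUm : MeasurableSet U := isOpen_interior.measurableSet
  have hZ : hermiteWeight n (pmInd K) 0 = (2 * γ.real U - 1) ^ 2 := by
    rw [hermiteWeight_zero, hermiteCoeff_pmInd_zero hK]
  by_cases hlow : γ.real U < 1 / 4
  · have : (1 / 4 : ℝ) ≤ (2 * γ.real U - 1) ^ 2 := by nlinarith
    linarith
  by_cases hhigh : 3 / 4 < γ.real U
  · have : (1 / 4 : ℝ) ≤ (2 * γ.real U - 1) ^ 2 := by nlinarith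
    linarith
  rw [not_lt] at hlow hhigh
  by_cases hball : Metric.closedBall 0 (1 / 64) ⊆ U
  · have hmain := hK.interior.stdGaussian_real_mul_compl_le hUm (by norm_num) hball
    have hwt := sq_setIntegral_sub_norm_sq_le_hermiteWeight hK
    rw [probReal_compl_eq_one_sub hUm, finrank_euclideanSpace_fin] at hmain
    set D := ∫ x in U, ((n : ℝ) - ‖x‖ ^ 2) ∂γ
    have hvar : 3 / 16 ≤ γ.real U * (1 - γ.real U) := by nlinarith
    have hDn : 3 / 2048 ≤ |D| * √n := by
      have h1 : 0 ≤ |D| * √n := by positivity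
      have h2 := Real.pi_le_four
      have h3 : Real.pi / 2 * (|D| * (√n / (1 / 64))) = Real.pi * (|D| * √n) * 32 := by ring
      nlinarith
    have hsq : (3 / 2048 : ℝ) ^ 2 ≤ D ^ 2 * n := by
      have := pow_le_pow_left₀ (by norm_num) hDn 2
      rwa [mul_pow, sq_abs, Real.sq_sqrt hn0.le] at this
    have hfin : (1 / 2 ^ 22 : ℝ) / (n : ℝ) ^ 2 ≤ hermiteWeight n (pmInd K) 2 := by
      rw [div_le_iff₀ (by positivity)]
      nlinarith [mul_le_mul_of_nonneg_left hwt hn0.le]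
    linarith
  · have hne : U.Nonempty := by
      by_contra h
      rw [Set.not_nonempty_iff_eq_empty] at h
      rw [h] at hlow
      norm_num at hlow
    obtain ⟨u, hu, hUu⟩ :=
      exists_norm_eq_one_forall_inner_le hK.interior isOpen_interior hne hball
    have hInt := setIntegral_inner_le_of_forall_inner_le hUm hu hUu hlow
    have hwt := sq_setIntegral_inner_le_hermiteWeight hK hu
    have : (1 / 128 : ℝ) ^ 2 ≤ (∫ x in U, inner ℝ u x ∂γ) ^ 2 := by nlinarith
    norm_num at this hcn ⊢
    linarith
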